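/- Let p ≡ 17 (mod 60) be prime and G = SL₂(ℤ/pℤ). Then the order |G| = (p−1)p(p+1), viewed as an integer multiple of the identity in ℤ[G], lies in the Scharlau ideal of G, i.e., the two-sided ideal of ℤ[G] generated by the elements Σ_{h∈H} h for nontrivial subgroups H ≤ G. -/

import Mathlib

open Matrix

/-- If `a + a⁻¹` commutes with `s`, then so does `a ^ n + a⁻¹ ^ n`. -/
lemma commute_pow_add_pow {R : Type*} [Ring R] {a b s : R} (hab : a * b = 1) (hba : b * a = 1)
    (h : Commute (a + b) s) (n : ℕ) : Commute (a ^ n + b ^ n) s := by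
  induction n using Nat.twoStepInduction with
  | zero => simp
  | one => simpa using h
  | more n h0 h1 =>
    have key : a ^ (n + 2) + b ^ (n + 2) =
        (a + b) * (a ^ (n + 1) + b ^ (n + 1)) - (a ^ n + b ^ n) := by
      have e1 : a * b ^ (n + 1) = b ^ n := by rw [pow_succ', ← mul_assoc, hab, one_mul]
      have e2 : b * a ^ (n + 1) = a ^ n := by rw [pow_succ', ← mul_assoc, hba, one_mul]
      rw [add_mul, mul_add, mul_add, e1, e2, ← pow_succ', ← pow_succ']
      abel
    rw [key]
    exact (h.mul_left h1).sub_left h0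

/-- The trace identities in a ring generated by the images of a unipotent `a` (with inverse `b`)
and of an element `s` of order four force `(a ^ 3 - 1) * (a ^ 5 - 1) = 0`. -/
lemma pow_three_sub_one_mul_pow_five_sub_one {R : Type*} [Ring R] {a b s : R}
    (hab : a * b = 1) (hba : b * a = 1) (hs : s * s = -1)
    (h2 : a ^ 2 * s - s * b ^ 2 = 1)
    (h4 : a ^ 4 * s * a * s + s * b * s * b ^ 4 = -1)
    (hy : Commute (a + b) s) : (a ^ 3 - 1) * (a ^ 5 - 1) = 0 := by
  have hya : Commute (a + b) a :=
    (Commute.refl a).add_left (show b * a = a * b by rw [hab, hba])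
  have hyb : Commute (a + b) b :=
    (show Commute a b from hab.trans hba.symm).add_left (Commute.refl b)
  set c := a * s - s * b with hc
  have hyc : Commute (a + b) c := (hya.mul_right hy).sub_right (hy.mul_right hyb)
  have hyc1 : (a + b) * c = 1 := by
    have : (a + b) * c = a * a * s + b * a * s - ((a + b) * s) * b := by
      rw [hc]; noncomm_ring
    have e : s * (a + b) * b = s * (a * b) + s * b ^ 2 := by noncomm_ring
    rw [this, hy.eq, hba, e, hab, one_mul, mul_one, ← h2]; noncomm_ring
  have hcy1 : c * (a + b) = 1 := by rw [← hyc.eq, hyc1]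
  have hcentral : ∀ t, Commute (a + b) t → c * t = t * c := fun t ht => by
    calc c * t = c * t * ((a + b) * c) := by rw [hyc1, mul_one]
      _ = c * (t * (a + b)) * c := by noncomm_ring
      _ = (c * (a + b)) * t * c := by rw [← ht.eq]; noncomm_ring
      _ = t * c := by rw [hcy1, one_mul]
  have hx : Commute (a ^ 2 + b ^ 2) s := commute_pow_add_pow hab hba hy 2
  have ha2 : a ^ 2 * b ^ 2 = 1 := by
    rw [pow_two, pow_two, mul_assoc, ← mul_assoc a b b, hab, one_mul, hab]
  have hb2 : b ^ 2 * a ^ 2 = 1 := by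
    rw [pow_two, pow_two, mul_assoc, ← mul_assoc b a a, hba, one_mul, hba]
  have hg : a ^ 4 * s - s * b ^ 4 = a ^ 2 + b ^ 2 := by
    calc a ^ 4 * s - s * b ^ 4
        = (a ^ 2 + b ^ 2) * a ^ 2 * s - (b ^ 2 * a ^ 2) * s -
          (s * (a ^ 2 + b ^ 2) * b ^ 2 - s * (a ^ 2 * b ^ 2)) := by noncomm_ring
      _ = (a ^ 2 + b ^ 2) * a ^ 2 * s - (a ^ 2 + b ^ 2) * s * b ^ 2 := by
          rw [ha2, hb2, ← hx.eq]; noncomm_ring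
      _ = (a ^ 2 + b ^ 2) * (a ^ 2 * s - s * b ^ 2) := by noncomm_ring
      _ = a ^ 2 + b ^ 2 := by rw [h2, mul_one]
  have hprod : (a ^ 2 + b ^ 2) * c = -1 + (a ^ 3 + b ^ 3) := by
    calc (a ^ 2 + b ^ 2) * c = a ^ 4 * s * c - (s * b ^ 4) * c := by rw [← hg]; noncomm_ring
      _ = a ^ 4 * s * c - c * (s * b ^ 4) := by rw [hcentral _ (hy.mul_right (hyb.pow_right 4))]
      _ = (a ^ 4 * s * a * s + s * b * s * b ^ 4) - a ^ 4 * (s * s) * b - a * (s * s) * b ^ 4 := by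
          rw [hc]; noncomm_ring
      _ = -1 + (a ^ 3 * (a * b) + (a * b) * b ^ 3) := by rw [h4, hs]; noncomm_ring
      _ = _ := by rw [hab]; noncomm_ring
  have hfin : a ^ 2 + b ^ 2 = -(a + b) + (a ^ 3 + b ^ 3) * (a + b) := by
    calc a ^ 2 + b ^ 2 = (a ^ 2 + b ^ 2) * (c * (a + b)) := by rw [hcy1, mul_one]
      _ = (a ^ 2 + b ^ 2) * c * (a + b) := by noncomm_ring
      _ = _ := by rw [hprod]; noncomm_ring
  have h3 : a ^ 3 * b = a ^ 2 := by rw [pow_succ, mul_assoc, hab, mul_one]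
  have h3' : b ^ 3 * a = b ^ 2 := by rw [pow_succ, mul_assoc, hba, mul_one]
  have hz : a ^ 4 + b ^ 4 - a - b = 0 := by
    have : (a ^ 3 + b ^ 3) * (a + b) = a ^ 4 + a ^ 3 * b + b ^ 3 * a + b ^ 4 := by noncomm_ring
    rw [this, h3, h3'] at hfin
    calc a ^ 4 + b ^ 4 - a - b = -(a + b) + (a ^ 4 + a ^ 2 + b ^ 2 + b ^ 4) - (a ^ 2 + b ^ 2) := by
          abel
      _ = 0 := by rw [← hfin, sub_self]
  have e4 : b ^ 4 * a ^ 4 = 1 := by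
    rw [← (show Commute b a from hba.trans hab.symm).mul_pow, hba, one_pow]
  calc (a ^ 3 - 1) * (a ^ 5 - 1) = (a ^ 4 + b ^ 4 - a - b) * a ^ 4 - b ^ 4 * a ^ 4 + b * a * a ^ 3
        + 1 - a ^ 3 := by noncomm_ring
    _ = 0 := by rw [hz, e4, hba]; noncomm_ring

/-- An element `a` with `a ^ p = 1`, `1 + a + ⋯ + a ^ (p - 1) = 0` and
`(a ^ 3 - 1) * (a ^ 5 - 1) = 0` can exist only in characteristic `p`. -/
lemma natCast_eq_zero_of_pow_sub_one_mul {R : Type*} [Ring R] {a : R} {p : ℕ} (hp : p % 60 = 17)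
    (ha : a ^ p = 1) (hsum : ∑ i ∈ Finset.range p, a ^ i = 0)
    (h : (a ^ 3 - 1) * (a ^ 5 - 1) = 0) : (p : R) = 0 := by
  have key : ∀ k m l : ℕ, k * m = p * l + 1 → (a ^ k) ^ m = a := fun k m l hkm => by
    rw [← pow_mul, hkm, pow_succ, pow_mul, ha, one_pow, one_mul]
  have h3 := geom_sum_mul (a ^ 3) ((p + 1) / 3)
  have h5 := mul_geom_sum (a ^ 5) ((2 * p + 1) / 5)
  rw [key 3 _ 1 (by omega)] at h3
  rw [key 5 _ 2 (by omega)] at h5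
  have hsq : (a - 1) * (a - 1) = 0 := by
    nth_rewrite 1 [← h3]
    rw [← h5, mul_assoc, ← mul_assoc (a ^ 3 - 1), h, zero_mul, mul_zero]
  have hpow : ∀ n : ℕ, a ^ n = 1 + (n : R) * (a - 1) := fun n => by
    induction n with
    | zero => simp
    | succ n ih =>
      have : (1 + (n : R) * (a - 1)) * a =
          1 + ((n : R) + 1) * (a - 1) + n * ((a - 1) * (a - 1)) := by noncomm_ring
      rw [pow_succ, ih, this, hsq]
      simp
  have hpa : (p : R) * (a - 1) = 0 := by simpa [ha] using hpow p
  have hmul : ∑ i ∈ Finset.range p, i = (p - 1) / 2 * p := by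
    rw [Finset.sum_range_id]
    obtain ⟨k, rfl⟩ : ∃ k, p = 2 * k + 1 := ⟨p / 2, by omega⟩
    rw [Nat.add_sub_cancel, Nat.mul_div_cancel_left _ two_pos, mul_left_comm,
      Nat.mul_div_cancel_left _ two_pos, mul_comm]
  have hmul' : ∑ i ∈ Finset.range p, (i : R) = ((p - 1) / 2 : ℕ) * (p : R) := by
    rw [← Nat.cast_sum, hmul, Nat.cast_mul]
  simp only [hpow, Finset.sum_add_distrib, ← Finset.sum_mul, hmul'] at hsum
  simpa [mul_assoc, hpa] using hsum

/-- The sum over the subgroup generated by `g`. -/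
lemma finsum_mem_zpowers {G M : Type*} [Group G] [Finite G] [AddCommMonoid M] (g : G) (f : G → M) :
    ∑ᶠ h ∈ (Subgroup.zpowers g : Set G), f h = ∑ i ∈ Finset.range (orderOf g), f (g ^ i) := by
  classical
  have : (Subgroup.zpowers g : Set G) = ((Finset.range (orderOf g)).image (g ^ ·) : Finset G) := by
    ext x
    exact (isOfFinOrder_of_finite g).mem_zpowers_iff_mem_range_orderOf
  rw [this, finsum_mem_coe_finset, Finset.sum_image]
  intro i hi j hj hij
  exact pow_injOn_Iio_orderOf (by simpa using hi) (by simpa using hj) hij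

/-- The upper unipotent matrix with entry `x`. -/
def upperUnipotent {F : Type*} [CommRing F] (x : F) : SpecialLinearGroup (Fin 2) F :=
  ⟨!![1, x; 0, 1], by simp⟩

lemma coe_upperUnipotent {F : Type*} [CommRing F] (x : F) :
    (upperUnipotent x : Matrix (Fin 2) (Fin 2) F) = !![1, x; 0, 1] := rfl

lemma upperUnipotent_mul {F : Type*} [CommRing F] (x y : F) :
    upperUnipotent x * upperUnipotent y = upperUnipotent (x + y) := by
  ext i j
  fin_cases i <;> fin_cases j <;> simp [coe_upperUnipotent, add_comm]

lemma upperUnipotent_zero {F : Type*} [CommRing F] : upperUnipotent (0 : F) = 1 := by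
  ext i j
  fin_cases i <;> fin_cases j <;> simp [coe_upperUnipotent]

lemma upperUnipotent_pow {F : Type*} [CommRing F] (x : F) (n : ℕ) :
    upperUnipotent x ^ n = upperUnipotent (n * x) := by
  induction n with
  | zero => simp [upperUnipotent_zero]
  | succ n ih => rw [pow_succ, ih, upperUnipotent_mul]; push_cast; ring_nf

/-- The standard element of order four in `SL₂`. -/
def weylElement (F : Type*) [CommRing F] : SpecialLinearGroup (Fin 2) F :=
  ⟨!![0, -1; 1, 0], by simp⟩

lemma coe_weylElement (F : Type*) [CommRing F] :
    (weylElement F : Matrix (Fin 2) (Fin 2) F) = !![0, -1; 1, 0] := rfl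

/-- If a homomorphism from `SL₂(𝔽ₚ)` to a ring kills the sums over all
cyclic subgroups of prime order, then the ring has characteristic dividing `p`. -/
lemma natCast_eq_zero_of_geom_sum_eq_zero {p : ℕ} [Fact p.Prime] (hp : p % 60 = 17)
    {R : Type*} [Ring R] (φ : SpecialLinearGroup (Fin 2) (ZMod p) →* R)
    (hφ : ∀ g, ∀ q : ℕ, q.Prime → g ^ q = 1 → g ≠ 1 → ∑ i ∈ Finset.range q, φ g ^ i = 0) :
    (p : R) = 0 := by
  have two_ne : (2 : ZMod p) ≠ 0 := by
    intro h
    have := (ZMod.natCast_eq_zero_iff 2 p).1 (by exact_mod_cast h)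
    have := Nat.le_of_dvd two_pos this
    omega
  obtain ⟨c, hc⟩ : ∃ c : ZMod p, 2 * c = 1 := ⟨2⁻¹, mul_inv_cancel₀ two_ne⟩
  have hc0 : c ≠ 0 := by rintro rfl; simp at hc
  have hneg : φ (-1) = -1 := by
    have hne : (-1 : SpecialLinearGroup (Fin 2) (ZMod p)) ≠ 1 := fun h => by
      have := congrArg (fun g => g.1 0 0) h
      simp at this
      exact two_ne (by linear_combination -this)
    have := hφ (-1) 2 Nat.prime_two (by simp) hne
    simp [Finset.sum_range_succ] at this
    exact (neg_eq_of_add_eq_zero_right this).symm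
  have hthree : ∀ w w', w * w = w' → w * w' = 1 → w ≠ 1 → 1 + φ w + φ w' = 0 :=
    fun w w' h h' hw => by
      have := hφ w 3 Nat.prime_three (by rw [pow_succ', pow_two, h, h']) hw
      simpa [Finset.sum_range_succ, pow_two, ← map_mul, h] using this
  set r := upperUnipotent c with hr
  set r' := upperUnipotent (-c) with hr'
  set s := weylElement (ZMod p) with hs
  have hrr' : r * r' = 1 := by rw [upperUnipotent_mul, add_neg_cancel, upperUnipotent_zero]
  have hr'r : r' * r = 1 := by rw [upperUnipotent_mul, neg_add_cancel, upperUnipotent_zero]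
  have hab : φ r * φ r' = 1 := by rw [← map_mul, hrr', map_one]
  have hba : φ r' * φ r = 1 := by rw [← map_mul, hr'r, map_one]
  have hss : φ s * φ s = -1 := by
    rw [← map_mul, ← hneg]
    congr 1
    ext i j
    fin_cases i <;> fin_cases j <;> simp [hs, coe_weylElement]
  have hr2 : r ^ 2 = upperUnipotent 1 := by
    rw [upperUnipotent_pow]; congr 1
  have hr2' : r' ^ 2 = upperUnipotent (-1) := by
    rw [upperUnipotent_pow]; congr 1; push_cast; linear_combination -hc
  have hr4 : r ^ 4 = upperUnipotent 2 := by
    rw [upperUnipotent_pow]; congr 1; push_cast; linear_combination 2 * hc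
  have hr4' : r' ^ 4 = upperUnipotent (-2) := by
    rw [upperUnipotent_pow]; congr 1; push_cast; linear_combination -2 * hc
  have h2 : φ r ^ 2 * φ s - φ s * φ r' ^ 2 = 1 := by
    have := hthree (-1 * (r ^ 2 * s)) (s * r' ^ 2) ?_ ?_ ?_
    · simp only [map_mul, map_pow, hneg] at this
      rw [← sub_eq_zero, ← neg_eq_zero, ← this]
      noncomm_ring
    · rw [hr2, hr2']
      ext i j
      fin_cases i <;> fin_cases j <;>
        simp [hs, coe_upperUnipotent, coe_weylElement]
    · rw [hr2, hr2']
      ext i j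
      fin_cases i <;> fin_cases j <;>
        simp [hs, coe_upperUnipotent, coe_weylElement]
    · intro h
      rw [hr2] at h
      have := congrArg (fun g => g.1 1 0) h
      simp [hs, coe_upperUnipotent, coe_weylElement] at this
  have hw : ((r ^ 4 * s * r * s : SpecialLinearGroup (Fin 2) (ZMod p)) :
      Matrix (Fin 2) (Fin 2) (ZMod p)) = !![0, -2; c, -1] := by
    rw [hr4]
    ext i j
    fin_cases i <;> fin_cases j <;> simp [hr, hs, coe_upperUnipotent, coe_weylElement]
    linear_combination hc
  have hw' : ((s * r' * s * r' ^ 4 : SpecialLinearGroup (Fin 2) (ZMod p)) :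
      Matrix (Fin 2) (Fin 2) (ZMod p)) = !![-1, 2; -c, 0] := by
    rw [hr4']
    ext i j
    fin_cases i <;> fin_cases j <;> simp [hr', hs, coe_upperUnipotent, coe_weylElement]
    linear_combination hc
  have h4 : φ r ^ 4 * φ s * φ r * φ s + φ s * φ r' * φ s * φ r' ^ 4 = -1 := by
    have := hthree (r ^ 4 * s * r * s) (s * r' * s * r' ^ 4) ?_ ?_ ?_
    · simp only [map_mul, map_pow] at this
      rw [← sub_eq_zero, ← this]
      noncomm_ring
    · refine Matrix.SpecialLinearGroup.ext _ _ fun i j => ?_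
      rw [Matrix.SpecialLinearGroup.coe_mul, hw, hw']
      fin_cases i <;> fin_cases j <;> simp
      · exact hc
      · linear_combination -hc
    · refine Matrix.SpecialLinearGroup.ext _ _ fun i j => ?_
      rw [Matrix.SpecialLinearGroup.coe_mul, hw, hw']
      fin_cases i <;> fin_cases j <;> simp [hc, mul_comm c]
    · intro h
      have h10 := congrFun₂ (hw.symm.trans (congrArg Subtype.val h)) 1 0
      exact hc0 (by simpa using h10)
  have hx : Commute (φ r ^ 2 + φ r' ^ 2) (φ s) := by
    have e1 : φ s * φ r' ^ 2 = φ r ^ 2 * φ s - 1 := by rw [← h2]; abel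
    have e2 : φ r' ^ 2 * φ s = φ s * φ r ^ 2 - 1 := by
      calc φ r' ^ 2 * φ s = -(φ s * φ s) * φ r' ^ 2 * φ s := by rw [hss]; noncomm_ring
        _ = -(φ s * (φ s * φ r' ^ 2)) * φ s := by noncomm_ring
        _ = -(φ s * φ r ^ 2 * (φ s * φ s)) + φ s * φ s := by rw [e1]; noncomm_ring
        _ = φ s * φ r ^ 2 - 1 := by rw [hss]; noncomm_ring
    rw [commute_iff_eq, add_mul, mul_add, e1, e2]
    abel
  have hrp : r ^ p = 1 := by rw [upperUnipotent_pow]; simp [upperUnipotent_zero]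
  have hr1 : r ≠ 1 := fun h =>
    hc0 (by simpa [hr, upperUnipotent] using congrArg (fun g => g.1 0 1) h)
  refine natCast_eq_zero_of_pow_sub_one_mul hp (by rw [← map_pow, hrp, map_one])
    (hφ r p Fact.out hrp hr1)
    (pow_three_sub_one_mul_pow_five_sub_one hab hba hss h2 h4 ?_)
  have hroot : ∀ t : R, t ^ p = 1 → (t ^ 2) ^ ((p + 1) / 2) = t := fun t ht => by
    rw [← pow_mul, show 2 * ((p + 1) / 2) = p + 1 by omega, pow_succ, ht, one_mul]
  have hrp' : r' ^ p = 1 := by rw [upperUnipotent_pow]; simp [upperUnipotent_zero]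
  have hinv : ∀ a b : R, a * b = 1 → a ^ 2 * b ^ 2 = 1 := fun a b h => by
    rw [pow_two, pow_two, mul_assoc, ← mul_assoc a b b, h, one_mul, h]
  rw [← hroot (φ r) (by rw [← map_pow, hrp, map_one]),
    ← hroot (φ r') (by rw [← map_pow, hrp', map_one])]
  exact commute_pow_add_pow (hinv _ _ hab) (hinv _ _ hba) hx _

theorem scharlau_stmt18 (p : ℕ) [Fact p.Prime] (hp : p % 60 = 17) :
    (((p : ℤ) - 1) * p * ((p : ℤ) + 1)) •
        (1 : MonoidAlgebra ℤ (Matrix.SpecialLinearGroup (Fin 2) (ZMod p))) ∈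
      TwoSidedIdeal.span {a : MonoidAlgebra ℤ (Matrix.SpecialLinearGroup (Fin 2) (ZMod p)) |
        ∃ H : Subgroup (Matrix.SpecialLinearGroup (Fin 2) (ZMod p)), H ≠ ⊥ ∧
          a = ∑ᶠ h ∈ (H : Set (Matrix.SpecialLinearGroup (Fin 2) (ZMod p))),
                MonoidAlgebra.single h (1 : ℤ)} := by
  set I := TwoSidedIdeal.span {a : MonoidAlgebra ℤ (SpecialLinearGroup (Fin 2) (ZMod p)) |
    ∃ H : Subgroup (SpecialLinearGroup (Fin 2) (ZMod p)), H ≠ ⊥ ∧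
      a = ∑ᶠ h ∈ (H : Set (SpecialLinearGroup (Fin 2) (ZMod p))),
        MonoidAlgebra.single h (1 : ℤ)}
  have hp0 : (p : I.ringCon.Quotient) = 0 := by
    refine natCast_eq_zero_of_geom_sum_eq_zero hp
      ((I.ringCon.mk' : _ →* I.ringCon.Quotient).comp (MonoidAlgebra.of ℤ _)) fun g q hq hgq hg => ?_
    have hord : orderOf g = q := by
      have := Fact.mk hq
      exact orderOf_eq_prime hgq hg
    have hmem : (∑ i ∈ Finset.range q, MonoidAlgebra.single (g ^ i) (1 : ℤ)) ∈ I :=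
      TwoSidedIdeal.subset_span ⟨Subgroup.zpowers g, by simpa using hg, by
        rw [finsum_mem_zpowers, hord]⟩
    rw [TwoSidedIdeal.mem_iff, ← RingCon.eq] at hmem
    simp only [MonoidHom.coe_comp, Function.comp_apply, ← map_pow]
    change ∑ i ∈ Finset.range q, I.ringCon.mk' (MonoidAlgebra.single (g ^ i) 1) = 0
    rw [← map_sum]
    exact hmem
  have hpI : (p : MonoidAlgebra ℤ (SpecialLinearGroup (Fin 2) (ZMod p))) ∈ I := by
    rw [TwoSidedIdeal.mem_iff, ← RingCon.eq]
    simpa using hp0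
  have e : (((p : ℤ) - 1) * p * ((p : ℤ) + 1)) •
      (1 : MonoidAlgebra ℤ (SpecialLinearGroup (Fin 2) (ZMod p))) =
      (((p : ℤ) - 1) * ((p : ℤ) + 1)) •
        (p : MonoidAlgebra ℤ (SpecialLinearGroup (Fin 2) (ZMod p))) := by
    rw [mul_right_comm, mul_smul]; simp
  rw [e]
  exact zsmul_mem hpI _
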